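/- Quartic matrix integral evaluation: for every k ≥ 1, ∫ exp(−Tr((Aᴴ A)²)) dA = (π^{k²} / (2^k · ∏_{j=0}^{k−1} (j!)²)) · det[Γ((a+b−1)/2)]_{a,b=1,…,k}, where the integral is over all k×k complex matrices A with respect to Lebesgue measure, Aᴴ is the conjugate transpose (so Tr((Aᴴ A)²) is real and nonnegative), and Γ is the Euler Gamma function. -/

import Mathlib

open MeasureTheory Matrix Finset

/-- Invariance of a function on square complex matrices under unitary conjugation. -/
def UnitarilyInvariant {ι : Type*} [Fintype ι] [DecidableEq ι] {α : Type*}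
    (F : Matrix ι ι ℂ → α) : Prop :=
  ∀ U ∈ Matrix.unitaryGroup ι ℂ, ∀ W, F (U * W * star U) = F W

theorem UnitarilyInvariant.eq_of_charpoly_eq {ι : Type*} [Fintype ι] [DecidableEq ι] {α : Type*}
    {F : Matrix ι ι ℂ → α} (hF : UnitarilyInvariant F) {A B : Matrix ι ι ℂ}
    (hA : A.IsHermitian) (hB : B.IsHermitian) (h : A.charpoly = B.charpoly) : F A = F B := by
  have key : ∀ {M : Matrix ι ι ℂ} (hM : M.IsHermitian),
      F M = F (diagonal (RCLike.ofReal ∘ hM.eigenvalues)) := by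
    intro M hM
    conv_lhs => rw [hM.spectral_theorem, Unitary.conjStarAlgAut_apply]
    exact hF _ hM.eigenvectorUnitary.2 _
  rw [key hA, key hB, (Matrix.IsHermitian.eigenvalues_eq_eigenvalues_iff hA hB).2 h]

theorem isHermitian_vecMulVec_star {ι : Type*} (a : ι → ℂ) :
    (vecMulVec (star a) a).IsHermitian := by
  ext i j; simp [vecMulVec, mul_comm]

theorem isHermitian_diagonal_ofReal {ι : Type*} [DecidableEq ι] (d : ι → ℝ) :
    (diagonal (fun i => (d i : ℂ))).IsHermitian := by
  rw [Matrix.IsHermitian, diagonal_conjTranspose]; congr 1; ext i; simp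

theorem eval_charpoly_diagonal_add_vecMulVec {ι : Type*} [Fintype ι] [DecidableEq ι]
    (d u v : ι → ℂ) {z : ℂ} (hz : ∀ i, z ≠ d i) :
    (diagonal d + vecMulVec u v).charpoly.eval z =
      (∏ i, (z - d i)) * (1 - ∑ i, u i * v i / (z - d i)) := by
  have hne : ∀ i, z - d i ≠ 0 := fun i => sub_ne_zero.2 (hz i)
  rw [Matrix.eval_charpoly]
  have h1 : Matrix.scalar ι z - (diagonal d + vecMulVec u v) =
      diagonal (fun i => z - d i) + replicateCol Unit (-u) * replicateRow Unit v := by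
    ext i j
    by_cases hij : i = j
    · subst hij
      simp [vecMulVec, Matrix.mul_apply, replicateCol, replicateRow]; ring
    · simp [vecMulVec, Matrix.mul_apply, replicateCol, replicateRow, hij]
  have hU : IsUnit (diagonal (fun i => z - d i)).det := by
    rw [det_diagonal]; exact (Finset.prod_ne_zero_iff.2 fun i _ => hne i).isUnit
  have hinv : (diagonal (fun i => z - d i))⁻¹ = diagonal (fun i => (z - d i)⁻¹) := by
    apply Matrix.inv_eq_left_inv
    rw [diagonal_mul_diagonal, ← diagonal_one]
    congr 1; ext i; exact inv_mul_cancel₀ (hne i)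
  rw [h1, det_add_replicateCol_mul_replicateRow hU, det_diagonal, hinv, det_unique]
  congr 1
  rw [Matrix.add_apply, Matrix.mul_apply]
  simp only [mul_diagonal, replicateRow_apply, replicateCol_apply, one_apply_eq, Pi.neg_apply]
  rw [sub_eq_add_neg, ← Finset.sum_neg_distrib]
  congr 1
  refine Finset.sum_congr rfl fun i _ => ?_
  field_simp

/-- The weights of the rank one perturbation taking the spectrum `σ` to the spectrum `x`. -/
noncomputable def rankOneWeight {K : Type*} [Field K] {m : ℕ} (σ x : Fin m → K) (i : Fin m) : K :=
  -(Lagrange.nodalWeight univ σ i * ∏ j, (σ i - x j))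

theorem prod_sub_mul_one_sub_sum_rankOneWeight {K : Type*} [Field K] {m : ℕ} {σ : Fin m → K}
    (hσ : Function.Injective σ) (x : Fin m → K) {z : K} (hz : ∀ i, z ≠ σ i) :
    (∏ i, (z - σ i)) * (1 - ∑ i, rankOneWeight σ x i / (z - σ i)) = ∏ i, (z - x i) := by
  set f := Lagrange.nodal univ x - Lagrange.nodal univ σ with hf
  have hdeg : f.degree < #(univ : Finset (Fin m)) := by
    rw [← Lagrange.degree_nodal (s := univ) (v := x)]
    apply Polynomial.degree_sub_lt_left
    · rw [Lagrange.degree_nodal, Lagrange.degree_nodal]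
    · exact Lagrange.nodal_ne_zero
    · rw [(Lagrange.nodal_monic).leadingCoeff, (Lagrange.nodal_monic).leadingCoeff]
  have h := Lagrange.eq_interpolate hσ.injOn hdeg
  have h2 := congrArg (Polynomial.eval z) h
  rw [Lagrange.eval_interpolate_not_at_node _ (fun i _ => hz i), hf, Polynomial.eval_sub,
    Lagrange.eval_nodal, Lagrange.eval_nodal, sub_eq_iff_eq_add] at h2
  rw [h2, mul_sub, mul_one, sub_eq_add_neg, add_comm, ← mul_neg, ← Finset.sum_neg_distrib]
  congr 2
  refine Finset.sum_congr rfl fun i _ => ?_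
  rw [Polynomial.eval_sub, Lagrange.eval_nodal_at_node (mem_univ i), Lagrange.eval_nodal,
    rankOneWeight]
  ring

/-- Strict interlacing `σ 0 < x 0 < σ 1 < x 1 < ⋯`. -/
def Interlaces {n : ℕ} (σ x : Fin (n + 1) → ℝ) : Prop :=
  (∀ i, σ i < x i) ∧ ∀ i : Fin n, x i.castSucc < σ i.succ

theorem Interlaces.strictMono {n : ℕ} {σ x : Fin (n + 1) → ℝ} (h : Interlaces σ x) :
    StrictMono x :=
  Fin.strictMono_iff_lt_succ.2 fun i => (h.2 i).trans (h.1 _)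

theorem Interlaces.lt_of_lt {n : ℕ} {σ x : Fin (n + 1) → ℝ} (h : Interlaces σ x)
    (hσ : StrictMono σ) {i j : Fin (n + 1)} (hij : j < i) : x j < σ i := by
  obtain ⟨j, rfl⟩ := Fin.exists_castSucc_eq.2 (Fin.ne_last_of_lt hij)
  refine (h.2 j).trans_le (hσ.monotone ?_)
  exact Fin.castSucc_lt_iff_succ_le.1 hij

theorem rankOneWeight_pos {n : ℕ} {σ x : Fin (n + 1) → ℝ} (h : Interlaces σ x)
    (hσ : StrictMono σ) (i : Fin (n + 1)) : 0 < rankOneWeight σ x i := by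
  rw [rankOneWeight, Lagrange.nodalWeight, ← Finset.mul_prod_erase univ _ (mem_univ i)]
  have : 0 < (x i - σ i) * ∏ j ∈ univ.erase i, ((σ i - σ j)⁻¹ * (σ i - x j)) := by
    refine mul_pos (sub_pos.2 (h.1 i)) (Finset.prod_pos fun j hj => ?_)
    rcases lt_or_gt_of_ne (Finset.ne_of_mem_erase hj) with hji | hji
    · exact mul_pos (inv_pos.2 (sub_pos.2 (hσ hji))) (sub_pos.2 (h.lt_of_lt hσ hji))
    · exact mul_pos_of_neg_of_neg (inv_lt_zero.2 (sub_neg.2 (hσ hji)))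
        (sub_neg.2 ((hσ hji).trans (h.1 j)))
  rw [Finset.prod_mul_distrib] at this
  linarith

theorem rankOneWeight_injOn {n : ℕ} {σ : Fin (n + 1) → ℝ} (hσ : StrictMono σ) :
    Set.InjOn (rankOneWeight σ) {x | Interlaces σ x} := by
  intro x hx y hy hxy
  have hp : Lagrange.nodal univ x = Lagrange.nodal univ y := by
    refine Polynomial.eq_of_degree_sub_lt_of_eval_index_eq univ hσ.injective.injOn ?_ ?_
    · rw [← Lagrange.degree_nodal (s := univ) (v := x)]
      apply Polynomial.degree_sub_lt_left
      · rw [Lagrange.degree_nodal, Lagrange.degree_nodal]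
      · exact Lagrange.nodal_ne_zero
      · rw [(Lagrange.nodal_monic).leadingCoeff, (Lagrange.nodal_monic).leadingCoeff]
    · intro i _
      have := congrFun hxy i
      rw [rankOneWeight, rankOneWeight, neg_inj] at this
      rw [Lagrange.eval_nodal, Lagrange.eval_nodal]
      exact mul_left_cancel₀ (Lagrange.nodalWeight_ne_zero hσ.injective.injOn (mem_univ i)) this
  have hr : Set.range x = Set.range y := by
    ext z
    have := congrArg (fun p => Polynomial.eval z p = 0) hp
    simp only [Lagrange.eval_nodal, Finset.prod_eq_zero_iff, mem_univ, true_and, sub_eq_zero,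
      eq_iff_iff] at this
    simpa [Set.mem_range, eq_comm] using this
  exact hx.strictMono.range_inj hy.strictMono |>.1 hr

theorem exists_interlaces_rankOneWeight {n : ℕ} {σ : Fin (n + 1) → ℝ} (hσ : StrictMono σ)
    {t : Fin (n + 1) → ℝ} (ht : ∀ i, 0 < t i) :
    ∃ x, Interlaces σ x ∧ rankOneWeight σ x = t := by
  set Q := Lagrange.nodal univ σ -
    ∑ i, Polynomial.C (t i) * Lagrange.nodal (univ.erase i) σ with hQ
  have hQσ : ∀ i, Q.eval (σ i) = -(t i * ∏ j ∈ univ.erase i, (σ i - σ j)) := by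
    intro i
    rw [hQ, Polynomial.eval_sub, Lagrange.eval_nodal_at_node (mem_univ i), zero_sub, neg_inj,
      Polynomial.eval_finsetSum, Finset.sum_eq_single i]
    · simp [Lagrange.eval_nodal]
    · intro j _ hj
      simp [Lagrange.eval_nodal_at_node (mem_erase.2 ⟨hj.symm, mem_univ i⟩)]
    · simp
  have hsum : (∑ i, Polynomial.C (t i) * Lagrange.nodal (univ.erase i) σ).degree <
      (Lagrange.nodal univ σ).degree := by
    rw [Lagrange.degree_nodal]
    refine (Polynomial.degree_sum_le _ _).trans_lt ?_
    rw [Finset.sup_lt_iff (WithBot.bot_lt_coe _)]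
    intro i _
    refine (Polynomial.degree_C_mul (ht i).ne').le.trans_lt ?_
    rw [Lagrange.degree_nodal, Finset.card_erase_of_mem (mem_univ i), Finset.card_fin]
    exact_mod_cast Nat.lt_succ_self n
  have hmonic : Q.Monic := Lagrange.nodal_monic.sub_of_left hsum
  have hdegQ : Q.degree = (n + 1 : ℕ) := by
    rw [hQ, Polynomial.degree_sub_eq_left_of_degree_lt hsum, Lagrange.degree_nodal]; simp
  have hbetween : ∀ i : Fin n, ∃ z, σ i.castSucc < z ∧ z < σ i.succ ∧ Q.eval z = 0 := by
    intro i
    have hlt : σ i.castSucc < σ i.succ := hσ Fin.castSucc_lt_succ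
    have hneg : Q.eval (σ i.castSucc) * Q.eval (σ i.succ) < 0 := by
      rw [hQσ, hQσ]
      have hne : i.castSucc ≠ i.succ := Fin.castSucc_lt_succ.ne
      rw [← Finset.mul_prod_erase (univ.erase i.castSucc) _ (mem_erase.2 ⟨hne.symm, mem_univ _⟩),
        ← Finset.mul_prod_erase (univ.erase i.succ) _ (mem_erase.2 ⟨hne, mem_univ _⟩),
        Finset.erase_right_comm]
      have hpos : 0 < (∏ j ∈ (univ.erase i.succ).erase i.castSucc, (σ i.castSucc - σ j)) *
          ∏ j ∈ (univ.erase i.succ).erase i.castSucc, (σ i.succ - σ j) := by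
        rw [← Finset.prod_mul_distrib]
        refine Finset.prod_pos fun j hj => ?_
        simp only [mem_erase, mem_univ, and_true] at hj
        rcases lt_or_gt_of_ne hj.1 with h | h
        · exact mul_pos (sub_pos.2 (hσ h)) (sub_pos.2 (hσ (h.trans Fin.castSucc_lt_succ)))
        · have : i.succ < j := lt_of_le_of_ne (Fin.castSucc_lt_iff_succ_le.1 h) hj.2.symm
          exact mul_pos_of_neg_of_neg (sub_neg.2 (hσ h)) (sub_neg.2 (hσ this))
      have h1 := mul_pos (mul_pos (ht i.castSucc) (ht i.succ)) hpos
      have h2 := mul_pos (mul_pos (sub_pos.2 hlt) (sub_pos.2 hlt)) h1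
      nlinarith [h2]
    rcases mul_neg_iff.1 hneg with ⟨h1, h2⟩ | ⟨h1, h2⟩
    · obtain ⟨z, hz, hz0⟩ := intermediate_value_Ioo' hlt.le Q.continuous.continuousOn ⟨h2, h1⟩
      exact ⟨z, hz.1, hz.2, hz0⟩
    · obtain ⟨z, hz, hz0⟩ := intermediate_value_Ioo hlt.le Q.continuous.continuousOn ⟨h1, h2⟩
      exact ⟨z, hz.1, hz.2, hz0⟩
  have hlast : ∃ z, σ (Fin.last n) < z ∧ Q.eval z = 0 := by
    have hneg : Q.eval (σ (Fin.last n)) < 0 := by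
      rw [hQσ, neg_lt_zero]
      refine mul_pos (ht _) (Finset.prod_pos fun j hj => sub_pos.2 (hσ ?_))
      exact Fin.lt_last_iff_ne_last.2 (Finset.ne_of_mem_erase hj)
    have htop : Filter.Tendsto (fun z => Q.eval z) Filter.atTop Filter.atTop := by
      apply Polynomial.tendsto_atTop_of_leadingCoeff_nonneg
      · rw [hdegQ]; exact_mod_cast Nat.succ_pos n
      · rw [hmonic.leadingCoeff]; exact zero_le_one
    obtain ⟨b, hb1, hb2⟩ :=
      ((htop.eventually_gt_atTop 0).and (Filter.eventually_gt_atTop (σ (Fin.last n)))).exists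
    obtain ⟨z, hz, hz0⟩ := intermediate_value_Ioo hb2.le Q.continuous.continuousOn ⟨hneg, hb1⟩
    exact ⟨z, hz.1, hz0⟩
  choose y hy1 hy2 hy3 using hbetween
  obtain ⟨w, hw1, hw2⟩ := hlast
  have hx : Interlaces σ (Fin.snoc y w : Fin (n + 1) → ℝ) := by
    constructor
    · intro i
      induction i using Fin.lastCases with
      | last => simpa using hw1
      | cast i => simpa using hy1 i
    · intro i; simpa using hy2 i
  refine ⟨Fin.snoc y w, hx, ?_⟩
  have hroot : ∀ i, Q.eval ((Fin.snoc y w : Fin (n + 1) → ℝ) i) = 0 := by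
    intro i
    induction i using Fin.lastCases with
    | last => simpa using hw2
    | cast i => simpa using hy3 i
  have hfact : Q = Lagrange.nodal univ (Fin.snoc y w : Fin (n + 1) → ℝ) := by
    refine Polynomial.eq_of_degree_sub_lt_of_eval_index_eq univ hx.strictMono.injective.injOn ?_ ?_
    · refine (Polynomial.degree_sub_lt_left ?_ hmonic.ne_zero ?_).trans_eq ?_
      · rw [hdegQ, Lagrange.degree_nodal]; simp
      · rw [hmonic.leadingCoeff, (Lagrange.nodal_monic).leadingCoeff]
      · rw [hdegQ]; simp
    · intro i _
      rw [hroot, Lagrange.eval_nodal_at_node (mem_univ i)]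
  ext i
  have h := hQσ i
  rw [hfact, Lagrange.eval_nodal] at h
  rw [rankOneWeight, h, Lagrange.nodalWeight, Finset.prod_inv_distrib]
  have : ∏ j ∈ univ.erase i, (σ i - σ j) ≠ 0 := Finset.prod_ne_zero_iff.2 fun j hj =>
    sub_ne_zero.2 (hσ.injective.ne (Finset.ne_of_mem_erase hj).symm)
  field_simp

theorem image_rankOneWeight {n : ℕ} {σ : Fin (n + 1) → ℝ} (hσ : StrictMono σ) :
    rankOneWeight σ '' {x | Interlaces σ x} = {t | ∀ i, 0 < t i} := by
  ext t
  constructor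
  · rintro ⟨x, hx, rfl⟩ i
    exact rankOneWeight_pos hx hσ i
  · intro ht
    obtain ⟨x, hx, rfl⟩ := exists_interlaces_rankOneWeight hσ ht
    exact ⟨x, hx, rfl⟩

theorem abs_prod_prod_erase_sub {m : ℕ} (x : Fin m → ℝ) :
    |∏ i, ∏ j ∈ univ.erase i, (x i - x j)| = (vandermonde x).det ^ 2 := by
  have hsplit : ∀ i : Fin m, univ.erase i = (Iio i).disjUnion (Ioi i)
      (Finset.disjoint_left.2 fun j h1 h2 => (mem_Iio.1 h1).asymm (mem_Ioi.1 h2)) := by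
    intro i; ext j; simp [lt_or_lt_iff_ne]
  have hswap : ∏ i, ∏ j ∈ Iio i, |x i - x j| = ∏ j, ∏ i ∈ Ioi j, |x i - x j| :=
    Finset.prod_comm' (by simp)
  rw [← sq_abs, det_vandermonde]
  simp_rw [hsplit, Finset.prod_disjUnion, Finset.abs_prod, abs_mul, Finset.abs_prod,
    Finset.prod_mul_distrib]
  rw [hswap, sq]
  congr 1
  simp_rw [abs_sub_comm]

theorem det_rankOneWeight_jacobian {m : ℕ} {σ x : Fin m → ℝ} (hσ : Function.Injective σ)
    (hx : Function.Injective x) :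
    |(Matrix.of fun i j => -(Lagrange.nodalWeight univ σ i *
      -∏ l ∈ univ.erase j, (σ i - x l))).det| =
      |(vandermonde x).det| / |(vandermonde σ).det| := by
  set Cf : Matrix (Fin m) (Fin m) ℝ :=
    Matrix.of fun i j => (Lagrange.nodal (univ.erase j) x).coeff i with hCf
  have hmul : ∀ v : Fin m → ℝ, vandermonde v * Cf =
      Matrix.of fun i j => ∏ l ∈ univ.erase j, (v i - x l) := by
    intro v
    ext i j
    rw [Matrix.mul_apply, of_apply, ← Lagrange.eval_nodal,
      Polynomial.eval_eq_sum_range' (n := m), ← Fin.sum_univ_eq_sum_range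
        (fun l => (Lagrange.nodal (univ.erase j) x).coeff l * v i ^ l)]
    · simp [vandermonde_apply, hCf, mul_comm]
    · rw [Lagrange.natDegree_nodal]
      simpa using Finset.card_erase_lt_of_mem (mem_univ j)
  have hx2 : (vandermonde x).det * Cf.det = ∏ i, ∏ j ∈ univ.erase i, (x i - x j) := by
    rw [← det_mul, hmul, ← det_diagonal]
    congr 1
    ext i j
    by_cases hij : i = j
    · subst hij; simp
    · rw [of_apply, diagonal_apply_ne _ hij]
      exact Finset.prod_eq_zero (mem_erase.2 ⟨hij, mem_univ i⟩) (sub_self _)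
  have hJ : (Matrix.of fun i j => -(Lagrange.nodalWeight univ σ i *
      -∏ l ∈ univ.erase j, (σ i - x l))) =
      diagonal (Lagrange.nodalWeight univ σ) * (vandermonde σ * Cf) := by
    rw [hmul]; ext i j; simp
  have hVx : (vandermonde x).det ≠ 0 := det_vandermonde_ne_zero_iff.2 hx
  have hVσ : (vandermonde σ).det ≠ 0 := det_vandermonde_ne_zero_iff.2 hσ
  have hC : |Cf.det| = |(vandermonde x).det| := by
    have := congrArg abs hx2
    rw [abs_prod_prod_erase_sub, abs_mul, ← sq_abs, sq] at this
    exact mul_left_cancel₀ (abs_ne_zero.2 hVx) this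
  rw [hJ, det_mul, det_mul, det_diagonal, abs_mul, abs_mul, hC]
  simp_rw [Lagrange.nodalWeight, Finset.prod_inv_distrib]
  rw [abs_inv, abs_prod_prod_erase_sub, ← sq_abs]
  have := abs_ne_zero.2 hVσ
  field_simp

theorem hasFDerivAt_rankOneWeight {m : ℕ} (σ x : Fin m → ℝ) :
    HasFDerivAt (rankOneWeight σ) (Matrix.toLin' (Matrix.of fun i j =>
      -(Lagrange.nodalWeight univ σ i *
        -∏ l ∈ univ.erase j, (σ i - x l)))).toContinuousLinearMap x := by
  rw [hasFDerivAt_pi']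
  intro i
  have h1 : ∀ j ∈ (univ : Finset (Fin m)), HasFDerivAt (fun y : Fin m → ℝ => σ i - y j)
      (-(ContinuousLinearMap.proj j : (Fin m → ℝ) →L[ℝ] ℝ)) x := fun j _ =>
    (hasFDerivAt_apply j x).const_sub (σ i)
  have h2 := ((HasFDerivAt.finsetProd h1).const_mul (Lagrange.nodalWeight univ σ i)).neg
  refine h2.congr_fderiv ?_
  ext v
  simp [Matrix.mulVec, dotProduct, Finset.mul_sum, mul_comm, mul_left_comm]

theorem isOpen_interlaces {n : ℕ} (σ : Fin (n + 1) → ℝ) : IsOpen {x | Interlaces σ x} := by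
  simp only [Interlaces, Set.ofPred_and, Set.ofPred_forall]
  exact (isOpen_iInter_of_finite fun i => isOpen_lt (by fun_prop) (by fun_prop)).inter
    (isOpen_iInter_of_finite fun i => isOpen_lt (by fun_prop) (by fun_prop))

theorem lintegral_pos_eq_lintegral_interlaces {n : ℕ} {σ : Fin (n + 1) → ℝ} (hσ : StrictMono σ)
    (g : (Fin (n + 1) → ℝ) → ENNReal) :
    ∫⁻ t in {t | ∀ i, 0 < t i}, g t = ∫⁻ x in {x | Interlaces σ x},
      ENNReal.ofReal (|(vandermonde x).det| / |(vandermonde σ).det|) * g (rankOneWeight σ x) := by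
  rw [← image_rankOneWeight hσ, lintegral_image_eq_lintegral_abs_det_fderiv_mul volume
    (isOpen_interlaces σ).measurableSet
    (fun x _ => (hasFDerivAt_rankOneWeight σ x).hasFDerivWithinAt) (rankOneWeight_injOn hσ)]
  refine setLIntegral_congr_fun (isOpen_interlaces σ).measurableSet fun x hx => ?_
  have hx' : Interlaces σ x := hx
  rw [← det_rankOneWeight_jacobian hσ.injective hx'.strictMono.injective, ContinuousLinearMap.det,
    LinearMap.coe_toContinuousLinearMap, LinearMap.det_toLin']

theorem map_complex_norm_sq : (volume : Measure ℂ).map (fun z => ‖z‖ ^ 2) =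
    ENNReal.ofReal Real.pi • volume.restrict (Set.Ioi (0 : ℝ)) := by
  have himg : (fun r : ℝ => r ^ 2) '' Set.Ioi 0 = Set.Ioi 0 := by
    ext t
    refine ⟨?_, fun ht => ⟨√t, Real.sqrt_pos.2 ht, Real.sq_sqrt (le_of_lt ht)⟩⟩
    rintro ⟨r, hr, rfl⟩
    exact pow_pos (Set.mem_Ioi.1 hr) 2
  refine Measure.ext_of_lintegral _ fun h hh => ?_
  rw [lintegral_map hh (by fun_prop), ← Complex.lintegral_comp_polarCoord_symm,
    lintegral_smul_measure, ← himg, lintegral_image_eq_lintegral_abs_deriv_mul measurableSet_Ioi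
      (f' := fun r => 2 * r) (fun r _ => by simpa using (hasDerivAt_pow 2 r).hasDerivWithinAt)
      (fun a ha b hb hab => by
        exact (pow_left_inj₀ (le_of_lt ha) (le_of_lt hb) two_ne_zero).1 hab)]
  have htarget : polarCoord.target = Set.Ioi (0 : ℝ) ×ˢ Set.Ioo (-Real.pi) Real.pi := rfl
  rw [htarget, Measure.volume_eq_prod, ← Measure.prod_restrict, lintegral_prod _ (by
    simp only [Complex.norm_polarCoord_symm, smul_eq_mul]
    fun_prop), smul_eq_mul, ← lintegral_const_mul _ (by fun_prop)]
  refine setLIntegral_congr_fun measurableSet_Ioi fun r hr => ?_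
  have hr' : 0 < r := hr
  simp only [Complex.norm_polarCoord_symm, smul_eq_mul, sq_abs, lintegral_const,
    Measure.restrict_apply_univ, Real.volume_Ioo, sub_neg_eq_add]
  rw [abs_of_pos (by positivity), ENNReal.ofReal_mul zero_le_two, ← two_mul,
    ENNReal.ofReal_mul zero_le_two]
  ring

theorem lintegral_norm_sq {n : ℕ} {g : (Fin n → ℝ) → ENNReal} (hg : Measurable g) :
    ∫⁻ a : Fin n → ℂ, g (fun i => ‖a i‖ ^ 2) =
      ENNReal.ofReal (Real.pi ^ n) * ∫⁻ t in {t | ∀ i, 0 < t i}, g t := by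
  have h1 : (volume : Measure (Fin n → ℂ)).map (fun a i => ‖a i‖ ^ 2) =
      ENNReal.ofReal (Real.pi ^ n) • volume.restrict {t : Fin n → ℝ | ∀ i, 0 < t i} := by
    have hset : {t : Fin n → ℝ | ∀ i, 0 < t i} = Set.univ.pi fun _ => Set.Ioi 0 := by
      ext t; simp
    have hsf : SigmaFinite ((volume : Measure ℂ).map (fun z => ‖z‖ ^ 2)) := by
      rw [map_complex_norm_sq]
      exact inferInstanceAs (SigmaFinite (Real.pi.toNNReal • volume.restrict (Set.Ioi (0 : ℝ))))
    rw [volume_pi, Measure.pi_map_pi (f := fun _ z => ‖z‖ ^ 2) fun _ => by fun_prop, hset,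
      volume_pi, Measure.restrict_pi_pi]
    refine Measure.pi_eq fun s hs => ?_
    simp_rw [map_complex_norm_sq]
    rw [Measure.smul_apply, Measure.pi_pi]
    simp [Finset.prod_mul_distrib, ENNReal.ofReal_pow Real.pi_pos.le]
  rw [← smul_eq_mul, ← lintegral_smul_measure, ← h1, lintegral_map hg (by fun_prop)]

theorem lintegral_sum_norm_sq (p : ℕ) {h : ℝ → ENNReal} (hh : Measurable h) :
    ∫⁻ a : Fin (p + 1) → ℂ, h (∑ i, ‖a i‖ ^ 2) =
      ENNReal.ofReal (Real.pi ^ (p + 1) / p.factorial) *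
        ∫⁻ t in Set.Ioi (0 : ℝ), ENNReal.ofReal (t ^ p) * h t := by
  induction p generalizing h with
  | zero =>
    have := (volume_preserving_funUnique (Fin 1) ℂ).lintegral_comp_emb
      (MeasurableEquiv.measurableEmbedding _) (fun z => h (‖z‖ ^ 2))
    simp only [MeasurableEquiv.funUnique_apply] at this
    simp only [pow_zero, ENNReal.ofReal_one, one_mul,
      Nat.factorial_zero, Nat.cast_one, div_one, pow_one, zero_add]
    have hsum : ∀ a : Fin (0 + 1) → ℂ, ∑ i, ‖a i‖ ^ 2 = ‖a default‖ ^ 2 := fun a =>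
      Fin.sum_univ_one _
    simp_rw [hsum]
    rw [← smul_eq_mul, ← lintegral_smul_measure, ← map_complex_norm_sq,
      lintegral_map hh (by fun_prop)]
    exact this
  | succ p ih =>
    have h0 := (volume_preserving_piFinSuccAbove (fun _ : Fin (p + 2) => ℂ) 0).symm
    rw [← h0.lintegral_comp_emb (MeasurableEquiv.measurableEmbedding _)]
    simp only [MeasurableEquiv.piFinSuccAbove_symm_apply, Fin.insertNthEquiv_zero,
      Fin.consEquiv_apply, Fin.sum_univ_succ (n := p + 1), Fin.cons_zero, Fin.cons_succ]
    rw [Measure.volume_eq_prod, lintegral_prod _ (by fun_prop)]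
    have hin : ∀ z : ℂ, ∫⁻ y : Fin (p + 1) → ℂ, h (‖z‖ ^ 2 + ∑ i, ‖y i‖ ^ 2) =
        ENNReal.ofReal (Real.pi ^ (p + 1) / p.factorial) *
          ∫⁻ t in Set.Ioi (0 : ℝ), ENNReal.ofReal (t ^ p) * h (‖z‖ ^ 2 + t) := fun z =>
      ih (h := fun t => h (‖z‖ ^ 2 + t)) (by fun_prop)
    simp_rw [hin]
    have hmeas : Measurable (fun q : ℝ × ℝ => ENNReal.ofReal (q.2 ^ p) * h (q.1 + q.2)) := by
      fun_prop
    have hmeas' : Measurable (fun u : ℝ =>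
        ∫⁻ t in Set.Ioi (0 : ℝ), ENNReal.ofReal (t ^ p) * h (u + t)) :=
      hmeas.lintegral_prod_right'
    have hmeas'' : Measurable (fun z : ℂ =>
        ∫⁻ t in Set.Ioi (0 : ℝ), ENNReal.ofReal (t ^ p) * h (‖z‖ ^ 2 + t)) :=
      hmeas'.comp (by fun_prop : Measurable fun z : ℂ => ‖z‖ ^ 2)
    rw [lintegral_const_mul _ hmeas'',
      ← lintegral_map (f := fun u : ℝ => ∫⁻ t in Set.Ioi (0 : ℝ), ENNReal.ofReal (t ^ p) * h (u + t))
        hmeas' (by fun_prop : Measurable fun z : ℂ => ‖z‖ ^ 2),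
      map_complex_norm_sq, lintegral_smul_measure, smul_eq_mul, ← mul_assoc]
    have hshift : ∀ u : ℝ, ∫⁻ t in Set.Ioi (0 : ℝ), ENNReal.ofReal (t ^ p) * h (u + t) =
        ∫⁻ w, (Set.Ioi u).indicator (fun w => ENNReal.ofReal ((w - u) ^ p) * h w) w := by
      intro u
      rw [← lintegral_indicator measurableSet_Ioi, ← lintegral_add_left_eq_self (μ := volume)
        ((Set.Ioi u).indicator fun w => ENNReal.ofReal ((w - u) ^ p) * h w) u]
      refine lintegral_congr fun t => ?_
      simp only [Set.indicator, Set.mem_Ioi, lt_add_iff_pos_right, add_sub_cancel_left]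
    simp_rw [hshift]
    rw [lintegral_lintegral_swap]
    rotate_left
    · have : (Function.uncurry fun u w : ℝ =>
          (Set.Ioi u).indicator (fun w => ENNReal.ofReal ((w - u) ^ p) * h w) w) =
          {q : ℝ × ℝ | q.1 < q.2}.indicator
            (fun q => ENNReal.ofReal ((q.2 - q.1) ^ p) * h q.2) := by
        ext ⟨u, w⟩; simp [Set.indicator]
      rw [this]
      exact (Measurable.indicator (by fun_prop)
        (measurableSet_lt measurable_fst measurable_snd)).aemeasurable
    have hinner : ∀ w : ℝ, ∫⁻ u in Set.Ioi (0 : ℝ),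
        (Set.Ioi u).indicator (fun w => ENNReal.ofReal ((w - u) ^ p) * h w) w =
        (Set.Ioi (0 : ℝ)).indicator
          (fun w => ENNReal.ofReal (w ^ (p + 1) / (p + 1)) * h w) w := by
      intro w
      by_cases hw : 0 < w
      · rw [Set.indicator_of_mem (Set.mem_Ioi.2 hw)]
        have e1 : ∀ u, (Set.Ioi u).indicator (fun w => ENNReal.ofReal ((w - u) ^ p) * h w) w =
            (Set.Iio w).indicator (fun u => ENNReal.ofReal ((w - u) ^ p) * h w) u := by
          intro u; simp [Set.indicator]
        simp_rw [e1]
        rw [setLIntegral_indicator measurableSet_Iio, lintegral_mul_const _ (by fun_prop),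
          Set.inter_comm, Set.Ioi_inter_Iio, restrict_Ioo_eq_restrict_Ioc,
          ← ofReal_integral_eq_lintegral_ofReal, ← intervalIntegral.integral_of_le hw.le]
        · congr 2
          rw [intervalIntegral.integral_comp_sub_left (fun u => u ^ p) w]
          simp
        · exact (Continuous.integrableOn_Icc (by fun_prop)).mono_set Set.Ioc_subset_Icc_self
        · filter_upwards [ae_restrict_mem measurableSet_Ioc] with u hu
          exact pow_nonneg (sub_nonneg.2 hu.2) p
      · rw [Set.indicator_of_notMem (by simpa using hw)]
        rw [setLIntegral_congr_fun (g := fun _ => 0) measurableSet_Ioi, lintegral_zero]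
        intro u hu
        exact Set.indicator_of_notMem (fun h' => hw ((Set.mem_Ioi.1 hu).trans h')) _
    simp_rw [hinner]
    rw [lintegral_indicator measurableSet_Ioi]
    have e2 : ∀ t : ℝ, 0 < t → ENNReal.ofReal (t ^ (p + 1) / (p + 1)) * h t =
        ENNReal.ofReal (1 / (p + 1)) * (ENNReal.ofReal (t ^ (p + 1)) * h t) := by
      intro t ht
      rw [← mul_assoc, ← ENNReal.ofReal_mul (by positivity)]
      congr 2; ring
    rw [setLIntegral_congr_fun measurableSet_Ioi fun t ht => e2 t ht,
      lintegral_const_mul _ (by fun_prop), ← mul_assoc,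
      ← ENNReal.ofReal_mul (by positivity), ← ENNReal.ofReal_mul (by positivity)]
    congr 2
    rw [Nat.factorial_succ]
    push_cast
    field_simp
    ring

theorem lintegral_cons_norm_sq {ι : Type*} [Fintype ι] {n p : ℕ} (e : ι ≃ Fin n ⊕ Fin (p + 1))
    {g : (Fin (n + 1) → ℝ) → ENNReal} (hg : Measurable g) :
    ∫⁻ a : ι → ℂ, g (Fin.cons (∑ j, ‖a (e.symm (Sum.inr j))‖ ^ 2)
        (fun i => ‖a (e.symm (Sum.inl i))‖ ^ 2)) =
      ENNReal.ofReal (Real.pi ^ (n + p + 1) / p.factorial) *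
        ∫⁻ t in {t | ∀ i, 0 < t i}, ENNReal.ofReal (t 0 ^ p) * g t := by
  have hcons : Measurable (fun q : ℝ × (Fin n → ℝ) => (Fin.cons q.1 q.2 : Fin (n + 1) → ℝ)) :=
    measurable_pi_iff.2 fun i => by
      induction i using Fin.cases with
      | zero => simpa using measurable_fst
      | succ i => simp only [Fin.cons_succ]; fun_prop
  have hgc : Measurable (fun q : ℝ × (Fin n → ℝ) => g (Fin.cons q.1 q.2)) := hg.comp hcons
  have h1 := (volume_measurePreserving_piCongrLeft (fun _ : ι => ℂ) e.symm).symm.trans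
    (volume_measurePreserving_sumPiEquivProdPi (fun _ : Fin n ⊕ Fin (p + 1) => ℂ))
  have h2 := h1.lintegral_comp_emb (MeasurableEquiv.measurableEmbedding _)
    (fun q : (Fin n → ℂ) × (Fin (p + 1) → ℂ) =>
      g (Fin.cons (∑ j, ‖q.2 j‖ ^ 2) (fun i => ‖q.1 i‖ ^ 2)))
  have h3 : ∀ a : ι → ℂ, ((MeasurableEquiv.piCongrLeft (fun _ : ι => ℂ) e.symm).symm.trans
      (MeasurableEquiv.sumPiEquivProdPi (fun _ : Fin n ⊕ Fin (p + 1) => ℂ))) a =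
      (fun i => a (e.symm (Sum.inl i)), fun j => a (e.symm (Sum.inr j))) := fun a => rfl
  simp only [h3] at h2
  have hgn : Measurable (fun q : (Fin n → ℂ) × (Fin (p + 1) → ℂ) =>
      g (Fin.cons (∑ j, ‖q.2 j‖ ^ 2) (fun i => ‖q.1 i‖ ^ 2))) :=
    hgc.comp (by fun_prop : Measurable fun q : (Fin n → ℂ) × (Fin (p + 1) → ℂ) =>
      (∑ j, ‖q.2 j‖ ^ 2, fun i => ‖q.1 i‖ ^ 2))
  rw [h2, Measure.volume_eq_prod, lintegral_prod _ hgn.aemeasurable]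
  have h4 : ∀ b : Fin n → ℂ,
      ∫⁻ c : Fin (p + 1) → ℂ, g (Fin.cons (∑ j, ‖c j‖ ^ 2) (fun i => ‖b i‖ ^ 2)) =
      ENNReal.ofReal (Real.pi ^ (p + 1) / p.factorial) * ∫⁻ t in Set.Ioi (0 : ℝ),
        ENNReal.ofReal (t ^ p) * g (Fin.cons t (fun i => ‖b i‖ ^ 2)) := fun b =>
    lintegral_sum_norm_sq p (h := fun t => g (Fin.cons t (fun i => ‖b i‖ ^ 2)))
      (hgc.comp (by fun_prop : Measurable fun t : ℝ => (t, fun i => ‖b i‖ ^ 2)))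
  simp_rw [h4]
  have hm : Measurable (fun q : (Fin n → ℝ) × ℝ =>
      ENNReal.ofReal (q.2 ^ p) * g (Fin.cons q.2 q.1)) :=
    (by fun_prop : Measurable fun q : (Fin n → ℝ) × ℝ => ENNReal.ofReal (q.2 ^ p)).mul
      (hgc.comp measurable_swap)
  have hm' : Measurable (fun s : Fin n → ℝ =>
      ∫⁻ t in Set.Ioi (0 : ℝ), ENNReal.ofReal (t ^ p) * g (Fin.cons t s)) :=
    hm.lintegral_prod_right'
  have hm'' : Measurable (fun b : Fin n → ℂ => ∫⁻ t in Set.Ioi (0 : ℝ),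
      ENNReal.ofReal (t ^ p) * g (Fin.cons t (fun i => ‖b i‖ ^ 2))) :=
    hm'.comp (by fun_prop : Measurable fun b : Fin n → ℂ => fun i => ‖b i‖ ^ 2)
  rw [lintegral_const_mul _ hm'', lintegral_norm_sq hm', ← mul_assoc,
    ← ENNReal.ofReal_mul (by positivity), lintegral_lintegral_swap hm.aemeasurable]
  congr 1
  · congr 1; ring
  have h5 := (volume_preserving_piFinSuccAbove (fun _ : Fin (n + 1) => ℝ) 0).symm
  rw [← h5.setLIntegral_comp_preimage_emb (MeasurableEquiv.measurableEmbedding _)]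
  have hpre : (MeasurableEquiv.piFinSuccAbove (fun _ : Fin (n + 1) => ℝ) 0).symm ⁻¹'
      {t | ∀ i, 0 < t i} = Set.Ioi 0 ×ˢ {t | ∀ i, 0 < t i} := by
    ext ⟨t, s⟩
    simp [MeasurableEquiv.piFinSuccAbove_symm_apply, Fin.forall_fin_succ]
  rw [hpre, Measure.volume_eq_prod, ← Measure.prod_restrict, lintegral_prod]
  · simp only [MeasurableEquiv.piFinSuccAbove_symm_apply, Fin.insertNthEquiv_zero]
    rfl
  · simp only [MeasurableEquiv.piFinSuccAbove_symm_apply, Fin.insertNthEquiv_zero,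
      Fin.consEquiv_apply, Fin.cons_zero]
    exact (hm.comp measurable_swap).aemeasurable

theorem integrable_prod_perm {n : ℕ} {μ : Fin n → Measure ℝ} [∀ i, SigmaFinite (μ i)]
    {f : Fin n → Fin n → ℝ → ℝ} (hf : ∀ i j, Integrable (f i j) (μ i)) (τ : Equiv.Perm (Fin n)) :
    Integrable (fun s : Fin n → ℝ => ∏ i, f i (τ i) (s i)) (Measure.pi μ) :=
  Integrable.fintype_prod_dep (f := fun i => f i (τ i)) fun i => hf i (τ i)

theorem integrable_det {n : ℕ} {μ : Fin n → Measure ℝ} [∀ i, SigmaFinite (μ i)]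
    {f : Fin n → Fin n → ℝ → ℝ} (hf : ∀ i j, Integrable (f i j) (μ i)) :
    Integrable (fun s : Fin n → ℝ => (of fun i j => f i j (s i)).det) (Measure.pi μ) := by
  simp_rw [fun s : Fin n → ℝ => (det_transpose (of fun i j => f i j (s i))).symm, det_apply',
    transpose_apply, of_apply]
  exact integrable_finsetSum _ fun τ _ => (integrable_prod_perm hf τ).const_mul _

theorem integral_det {n : ℕ} {μ : Fin n → Measure ℝ} [∀ i, SigmaFinite (μ i)]
    {f : Fin n → Fin n → ℝ → ℝ} (hf : ∀ i j, Integrable (f i j) (μ i)) :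
    ∫ s, (of fun i j => f i j (s i)).det ∂Measure.pi μ = (of fun i j => ∫ x, f i j x ∂μ i).det := by
  simp_rw [fun s : Fin n → ℝ => (det_transpose (of fun i j => f i j (s i))).symm]
  rw [← det_transpose]
  simp_rw [det_apply', transpose_apply, of_apply]
  rw [integral_finsetSum _ fun τ _ => (integrable_prod_perm hf τ).const_mul _]
  refine Finset.sum_congr rfl fun τ _ => ?_
  rw [integral_const_mul, integral_fintype_prod_eq_prod (f := fun i => f i (τ i))]

theorem det_sub_pow_div {n : ℕ} (x : Fin (n + 1) → ℝ) :
    (of fun i j : Fin n => (x i.succ ^ (j.1 + 1) - x i.castSucc ^ (j.1 + 1)) / (j.1 + 1)).det =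
      (vandermonde x).det / n.factorial := by
  have h1 : (of fun i j : Fin n => (x i.succ ^ (j.1 + 1) - x i.castSucc ^ (j.1 + 1)) / (j.1 + 1)) =
      of fun i j : Fin n => ((j.1 : ℝ) + 1)⁻¹ *
        (of fun i j : Fin n => x i.succ ^ (j.1 + 1) - x i.castSucc ^ (j.1 + 1)) i j := by
    ext i j; simp [div_eq_inv_mul]
  have h2 : ∏ j : Fin n, ((j.1 : ℝ) + 1)⁻¹ = (n.factorial : ℝ)⁻¹ := by
    rw [Finset.prod_inv_distrib, Fin.prod_univ_eq_prod_range (fun j => (j : ℝ) + 1),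
      ← Finset.prod_range_add_one_eq_factorial]
    push_cast; rfl
  have h3 : (vandermonde x).det =
      (of (Fin.cons (fun j : Fin (n + 1) => x 0 ^ j.1)
        fun (i : Fin n) (j : Fin (n + 1)) => x i.succ ^ j.1 - x i.castSucc ^ j.1)).det := by
    refine det_eq_of_forall_row_eq_smul_add_pred (fun _ => 1) (fun j => by simp) fun i j => ?_
    simp
  rw [h1, det_mul_row, h2, h3, det_succ_column_zero, Fin.sum_univ_succ]
  simp only [Fin.val_zero, pow_zero, of_apply, Fin.cons_zero, Fin.cons_succ, sub_self, mul_zero,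
    zero_mul, Finset.sum_const_zero, add_zero, one_mul]
  rw [div_eq_inv_mul]
  congr 1

theorem det_vandermonde_pos {n : ℕ} {s : Fin n → ℝ} (hs : StrictMono s) :
    0 < (vandermonde s).det := by
  rw [det_vandermonde]
  exact Finset.prod_pos fun i _ => Finset.prod_pos fun j hj => sub_pos.2 (hs (mem_Ioi.1 hj))

theorem lintegral_vandermonde_box {n : ℕ} {x : Fin (n + 1) → ℝ} (hx : StrictMono x) :
    ∫⁻ s in {s : Fin n → ℝ | ∀ i, x i.castSucc < s i ∧ s i < x i.succ},
      ENNReal.ofReal (vandermonde s).det =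
    ENNReal.ofReal ((vandermonde x).det / n.factorial) := by
  have hset : {s : Fin n → ℝ | ∀ i, x i.castSucc < s i ∧ s i < x i.succ} =
      Set.univ.pi fun i => Set.Ioo (x i.castSucc) (x i.succ) := by
    ext s; simp
  have hmeas : MeasurableSet {s : Fin n → ℝ | ∀ i, x i.castSucc < s i ∧ s i < x i.succ} := by
    rw [hset]; exact MeasurableSet.univ_pi fun _ => measurableSet_Ioo
  have hint : ∀ i j : Fin n, Integrable (fun y : ℝ => y ^ j.1)
      (volume.restrict (Set.Ioo (x i.castSucc) (x i.succ))) := fun i j =>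
    (Continuous.integrableOn_Icc (by fun_prop)).mono_set Set.Ioo_subset_Icc_self
  have hvol : (volume : Measure (Fin n → ℝ)).restrict
      {s : Fin n → ℝ | ∀ i, x i.castSucc < s i ∧ s i < x i.succ} =
      Measure.pi fun i => volume.restrict (Set.Ioo (x i.castSucc) (x i.succ)) := by
    rw [hset, volume_pi, Measure.restrict_pi_pi]
  have hI := integrable_det hint
  rw [← hvol] at hI
  change Integrable (fun s => (vandermonde s).det) _ at hI
  rw [← ofReal_integral_eq_lintegral_ofReal hI]
  · rw [hvol]
    change ENNReal.ofReal (∫ s : Fin n → ℝ, (of fun i j : Fin n => s i ^ j.1).det ∂_) = _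
    rw [integral_det (f := fun i j y => y ^ j.1) hint, ← det_sub_pow_div]
    congr 3
    ext i j
    rw [← integral_Ioc_eq_integral_Ioo, ← intervalIntegral.integral_of_le
      (hx Fin.castSucc_lt_succ).le, integral_pow]
  · filter_upwards [ae_restrict_mem hmeas] with s hs
    exact (det_vandermonde_pos fun i j hij => (hs i).2.trans_le
      ((hx.monotone (Fin.succ_le_castSucc_iff.2 hij)).trans (hs j).1.le)).le

theorem measurePreserving_vecMul_of_mem_unitaryGroup {ι : Type*} [Fintype ι] [DecidableEq ι]
    {U : Matrix ι ι ℂ} (hU : U ∈ unitaryGroup ι ℂ) :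
    MeasurePreserving (fun a : ι → ℂ => a ᵥ* U) := by
  set L : (ι → ℂ) →ₗ[ℝ] (ι → ℂ) := (Matrix.toLin' Uᵀ).restrictScalars ℝ with hL
  have hLa : (fun a : ι → ℂ => a ᵥ* U) = L := by
    ext a i; simp [hL, Matrix.mulVec_transpose]
  have hdet : LinearMap.det L = 1 := by
    rw [hL, LinearMap.det_restrictScalars, LinearMap.det_toLin', det_transpose,
      Algebra.norm_complex_apply]
    have h : star U.det * U.det = 1 := (Unitary.mem_iff.1 (det_of_mem_unitary hU)).1
    exact Complex.ofReal_injective (Complex.normSq_eq_conj_mul_self.trans h)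
  rw [hLa]
  refine ⟨L.continuous_of_finiteDimensional.measurable, ?_⟩
  rw [Measure.map_linearMap_addHaar_eq_smul_addHaar _ (by rw [hdet]; exact one_ne_zero), hdet]
  simp

theorem measurable_lintegral_add_vecMulVec {ι : Type*} [Fintype ι] {F : Matrix ι ι ℂ → ENNReal}
    (hF : Measurable fun A : ι → ι → ℂ => F (of A)) :
    Measurable fun A : ι → ι → ℂ => ∫⁻ a : ι → ℂ, F (of A + vecMulVec (star a) a) := by
  have h : Measurable fun q : (ι → ι → ℂ) × (ι → ℂ) =>
      F (of fun i j => q.1 i j + star (q.2 i) * q.2 j) :=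
    hF.comp (by fun_prop : Measurable fun q : (ι → ι → ℂ) × (ι → ℂ) =>
      fun i j => q.1 i j + star (q.2 i) * q.2 j)
  exact h.lintegral_prod_right'

theorem UnitarilyInvariant.lintegral_add_vecMulVec {ι : Type*} [Fintype ι] [DecidableEq ι]
    {F : Matrix ι ι ℂ → ENNReal} (hF : UnitarilyInvariant F)
    (hFm : Measurable fun A : ι → ι → ℂ => F (of A)) :
    UnitarilyInvariant fun W => ∫⁻ a : ι → ℂ, F (W + vecMulVec (star a) a) := by
  intro U hU W
  have hm : ∀ V : Matrix ι ι ℂ, Measurable fun a : ι → ℂ => F (V + vecMulVec (star a) a) := by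
    intro V
    exact hFm.comp (by fun_prop : Measurable fun (a : ι → ℂ) i j => V i j + star (a i) * a j)
  have hU' : star U ∈ unitaryGroup ι ℂ := Unitary.star_mem hU
  dsimp only
  rw [← (measurePreserving_vecMul_of_mem_unitaryGroup hU').lintegral_comp (hm _)]
  refine lintegral_congr fun b => ?_
  rw [← hF U hU (W + vecMulVec (star b) b), mul_add, add_mul]
  congr 2
  rw [mul_vecMulVec, vecMulVec_mul, star_vecMul, star_eq_conjTranspose, conjTranspose_conjTranspose]

theorem charpoly_eq_of_eval_eq {ι : Type*} [Fintype ι] [DecidableEq ι] {A B : Matrix ι ι ℂ}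
    {T : Set ℂ} (hT : T.Finite) (h : ∀ z, z ∉ T → A.charpoly.eval z = B.charpoly.eval z) :
    A.charpoly = B.charpoly :=
  Polynomial.eq_of_infinite_eval_eq _ _ (hT.infinite_compl.mono h)

/-- The diagonal matrix with entries `s` followed by zeros, with respect to the labelling `e`. -/
noncomputable def paddedDiagonal {ι : Type*} [DecidableEq ι] {n p : ℕ} (e : ι ≃ Fin n ⊕ Fin p)
    (s : Fin n → ℝ) : Matrix ι ι ℂ :=
  diagonal fun i => ((Sum.elim s 0 (e i) : ℝ) : ℂ)

/-- The squared norms of the components of `a` in the eigenspaces of `paddedDiagonal e s`. -/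
noncomputable def eigenspaceNormSq {ι : Type*} {n p : ℕ} (e : ι ≃ Fin n ⊕ Fin (p + 1)) (a : ι → ℂ) :
    Fin (n + 1) → ℝ :=
  Fin.cons (∑ j, ‖a (e.symm (Sum.inr j))‖ ^ 2) fun i => ‖a (e.symm (Sum.inl i))‖ ^ 2

theorem isHermitian_paddedDiagonal {ι : Type*} [DecidableEq ι] {n p : ℕ} (e : ι ≃ Fin n ⊕ Fin p)
    (s : Fin n → ℝ) : (paddedDiagonal e s).IsHermitian :=
  isHermitian_diagonal_ofReal _

theorem measurable_paddedDiagonal {ι : Type*} [Fintype ι] [DecidableEq ι] {n p : ℕ}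
    (e : ι ≃ Fin n ⊕ Fin p) {F : Matrix ι ι ℂ → ENNReal}
    (hF : Measurable fun A : ι → ι → ℂ => F (of A)) :
    Measurable fun s => F (paddedDiagonal e s) := by
  refine hF.comp (g := fun A => F (of A)) (f := fun s => of.symm (paddedDiagonal e s)) ?_
  refine measurable_pi_iff.2 fun i => measurable_pi_iff.2 fun j => ?_
  simp only [paddedDiagonal, of_symm_apply, diagonal_apply]
  split_ifs
  · rcases e i with k | k
    · simp only [Sum.elim_inl]; fun_prop
    · simp
  · exact measurable_const

theorem eval_charpoly_paddedDiagonal {ι : Type*} [Fintype ι] [DecidableEq ι] {n p : ℕ}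
    (e : ι ≃ Fin n ⊕ Fin p) (s : Fin n → ℝ) (z : ℂ) :
    (paddedDiagonal e s).charpoly.eval z = z ^ p * ∏ i, (z - s i) := by
  rw [paddedDiagonal, charpoly_diagonal, Polynomial.eval_prod,
    ← e.symm.prod_comp, Fintype.prod_sum_type]
  simp [mul_comm]

theorem eval_charpoly_paddedDiagonal_add_vecMulVec {ι : Type*} [Fintype ι] [DecidableEq ι]
    {n p : ℕ} (e : ι ≃ Fin n ⊕ Fin (p + 1)) (s : Fin n → ℝ) (a : ι → ℂ) {z : ℂ} (hz : z ≠ 0)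
    (hzs : ∀ i, z ≠ s i) :
    (paddedDiagonal e s + vecMulVec (star a) a).charpoly.eval z =
      z ^ p * ((∏ i : Fin (n + 1), (z - ((Fin.cons 0 s : Fin (n + 1) → ℝ) i : ℝ))) *
        (1 - ∑ i : Fin (n + 1), (eigenspaceNormSq e a i : ℂ) /
          (z - ((Fin.cons 0 s : Fin (n + 1) → ℝ) i : ℝ)))) := by
  have hp : ∏ i : Fin (n + 1), (z - ((Fin.cons 0 s : Fin (n + 1) → ℝ) i : ℝ)) =
      z * ∏ i, (z - s i) := by simp [Fin.prod_univ_succ]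
  have hs : ∑ i : Fin (n + 1), (eigenspaceNormSq e a i : ℂ) /
      (z - ((Fin.cons 0 s : Fin (n + 1) → ℝ) i : ℝ)) =
      (∑ j, (‖a (e.symm (Sum.inr j))‖ : ℂ) ^ 2) / z +
        ∑ i, (‖a (e.symm (Sum.inl i))‖ : ℂ) ^ 2 / (z - s i) := by
    simp [eigenspaceNormSq, Fin.sum_univ_succ]
  have hn : ∀ w : ℂ, star w * w = (‖w‖ : ℂ) ^ 2 := Complex.conj_mul'
  rw [hp, hs, paddedDiagonal, eval_charpoly_diagonal_add_vecMulVec, ← e.symm.prod_comp,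
    ← e.symm.sum_comp, Fintype.prod_sum_type, Fintype.sum_sum_type]
  · simp only [Equiv.apply_symm_apply, Sum.elim_inl, Sum.elim_inr, Pi.zero_apply, Pi.star_apply,
      hn, Complex.ofReal_zero, sub_zero, Finset.prod_const, Finset.card_univ, Fintype.card_fin,
      Finset.sum_div]
    ring
  · intro i
    rcases e i with k | k
    · simpa using hzs k
    · simpa using hz

theorem ofReal_rankOneWeight {m : ℕ} (σ x : Fin m → ℝ) (i : Fin m) :
    ((rankOneWeight σ x i : ℝ) : ℂ) =
      rankOneWeight (fun j => (σ j : ℂ)) (fun j => (x j : ℂ)) i := by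
  simp [rankOneWeight, Lagrange.nodalWeight]

theorem charpoly_paddedDiagonal_add_vecMulVec_eq {ι : Type*} [Fintype ι] [DecidableEq ι]
    {n p : ℕ} (e : ι ≃ Fin n ⊕ Fin (p + 1)) (e' : ι ≃ Fin (n + 1) ⊕ Fin p) {s : Fin n → ℝ}
    (hs : StrictMono (Fin.cons 0 s : Fin (n + 1) → ℝ)) {a : ι → ℂ} {x : Fin (n + 1) → ℝ}
    (ha : eigenspaceNormSq e a = rankOneWeight (Fin.cons 0 s) x) :
    (paddedDiagonal e s + vecMulVec (star a) a).charpoly = (paddedDiagonal e' x).charpoly := by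
  refine charpoly_eq_of_eval_eq
    (Set.finite_range fun i => (((Fin.cons 0 s : Fin (n + 1) → ℝ) i : ℝ) : ℂ)) fun z hz => ?_
  have hz' : ∀ i, z ≠ (((Fin.cons 0 s : Fin (n + 1) → ℝ) i : ℝ) : ℂ) := fun i h => hz ⟨i, h.symm⟩
  rw [eval_charpoly_paddedDiagonal_add_vecMulVec e s a (by simpa using hz' 0)
    (fun i => by simpa using hz' i.succ), eval_charpoly_paddedDiagonal, ha]
  simp_rw [ofReal_rankOneWeight]
  rw [prod_sub_mul_one_sub_sum_rankOneWeight
    (σ := fun j => (((Fin.cons 0 s : Fin (n + 1) → ℝ) j : ℝ) : ℂ))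
    (Complex.ofReal_injective.comp hs.injective) _ hz']

/-- A vector whose components have squared norms `t` in the eigenspaces of a padded diagonal
matrix. -/
noncomputable def sqrtVector {ι : Type*} {n p : ℕ} (e : ι ≃ Fin n ⊕ Fin (p + 1))
    (t : Fin (n + 1) → ℝ) : ι → ℂ :=
  fun i => Sum.elim (fun k => ((√(t k.succ) : ℝ) : ℂ)) (Pi.single 0 ((√(t 0) : ℝ) : ℂ)) (e i)

theorem eigenspaceNormSq_sqrtVector {ι : Type*} {n p : ℕ} (e : ι ≃ Fin n ⊕ Fin (p + 1))
    {t : Fin (n + 1) → ℝ} (ht : ∀ i, 0 ≤ t i) : eigenspaceNormSq e (sqrtVector e t) = t := by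
  ext i
  induction i using Fin.cases with
  | zero =>
    simp only [eigenspaceNormSq, sqrtVector, Fin.cons_zero, Equiv.apply_symm_apply, Sum.elim_inr]
    rw [Finset.sum_eq_single 0]
    · simp [Real.sq_sqrt (ht 0)]
    · intro j _ hj; simp [hj]
    · simp
  | succ i => simp [eigenspaceNormSq, sqrtVector, Real.sq_sqrt (ht i.succ)]

theorem measurable_sqrtVector {ι : Type*} {n p : ℕ} (e : ι ≃ Fin n ⊕ Fin (p + 1)) :
    Measurable (sqrtVector e) := by
  refine measurable_pi_iff.2 fun i => ?_
  simp only [sqrtVector]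
  rcases e i with k | k
  · simp only [Sum.elim_inl]; fun_prop
  · simp only [Sum.elim_inr, Pi.single_apply]
    split_ifs
    · fun_prop
    · exact measurable_const

theorem det_vandermonde_cons_zero {n : ℕ} (s : Fin n → ℝ) :
    (vandermonde (Fin.cons 0 s : Fin (n + 1) → ℝ)).det = (∏ i, s i) * (vandermonde s).det := by
  rw [det_vandermonde, Fin.prod_univ_succ]
  congr 1
  · have : (Ioi (0 : Fin (n + 1))) = univ.map (Fin.succEmb n) := by
      ext i; simp [Fin.exists_succ_eq]
    rw [this, Finset.prod_map]; simp
  · rw [det_vandermonde]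
    refine Finset.prod_congr rfl fun i _ => ?_
    rw [Fin.Ioi_succ, Finset.prod_map]; simp

theorem rankOneWeight_cons_zero {n : ℕ} (s : Fin n → ℝ) (x : Fin (n + 1) → ℝ) :
    rankOneWeight (Fin.cons 0 s : Fin (n + 1) → ℝ) x 0 = (∏ j, x j) / ∏ i, s i := by
  have h : (univ.erase (0 : Fin (n + 1))) = univ.map (Fin.succEmb n) := by
    ext i; simp [Fin.exists_succ_eq]
  rw [rankOneWeight, Lagrange.nodalWeight, h, Finset.prod_map, Fin.prod_univ_succ,
    Fin.prod_univ_succ]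
  simp only [Fin.cons_zero, Fin.coe_succEmb, Fin.cons_succ, zero_sub, inv_neg, Finset.prod_neg,
    Finset.prod_inv_distrib, Finset.card_univ, Fintype.card_fin]
  rw [div_eq_mul_inv]
  have : ((-1 : ℝ) ^ n) * (-1) ^ n = 1 := by rw [← mul_pow]; simp
  linear_combination (x 0 * (∏ i : Fin n, x i.succ) * (∏ i, s i)⁻¹) * this

theorem lintegral_paddedDiagonal_add_vecMulVec {ι : Type*} [Fintype ι] [DecidableEq ι]
    {n p : ℕ} (e : ι ≃ Fin n ⊕ Fin (p + 1)) (e' : ι ≃ Fin (n + 1) ⊕ Fin p) {s : Fin n → ℝ}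
    (hs : StrictMono (Fin.cons 0 s : Fin (n + 1) → ℝ)) {F : Matrix ι ι ℂ → ENNReal}
    (hF : UnitarilyInvariant F) (hFm : Measurable fun A : ι → ι → ℂ => F (of A)) :
    ∫⁻ a : ι → ℂ, F (paddedDiagonal e s + vecMulVec (star a) a) =
      ENNReal.ofReal (Real.pi ^ (n + p + 1) / p.factorial) *
        ∫⁻ x in {x | Interlaces (Fin.cons 0 s) x},
          ENNReal.ofReal ((vandermonde x).det * (∏ j, x j) ^ p /
            ((vandermonde s).det * (∏ i, s i) ^ (p + 1))) * F (paddedDiagonal e' x) := by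
  set Ψ : (Fin (n + 1) → ℝ) → ENNReal := fun t =>
    F (paddedDiagonal e s + vecMulVec (star (sqrtVector e t)) (sqrtVector e t)) with hΨ
  have hherm : ∀ a : ι → ℂ, (paddedDiagonal e s + vecMulVec (star a) a).IsHermitian := fun a =>
    (isHermitian_paddedDiagonal e s).add (isHermitian_vecMulVec_star a)
  have hΨm : Measurable Ψ := by
    have hv := measurable_sqrtVector e
    exact hFm.comp (f := fun t i j =>
      paddedDiagonal e s i j + star (sqrtVector e t i) * sqrtVector e t j) (by fun_prop)
  have h1 : ∀ a : ι → ℂ, F (paddedDiagonal e s + vecMulVec (star a) a) =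
      Ψ (eigenspaceNormSq e a) := by
    intro a
    refine hF.eq_of_charpoly_eq (hherm _) (hherm _) (charpoly_eq_of_eval_eq
      (Set.finite_range fun i => (((Fin.cons 0 s : Fin (n + 1) → ℝ) i : ℝ) : ℂ)) fun z hz => ?_)
    have hz' : ∀ i, z ≠ (((Fin.cons 0 s : Fin (n + 1) → ℝ) i : ℝ) : ℂ) :=
      fun i h => hz ⟨i, h.symm⟩
    have hz0 : z ≠ 0 := by simpa using hz' 0
    have hzs : ∀ i, z ≠ s i := fun i => by simpa using hz' i.succ
    rw [eval_charpoly_paddedDiagonal_add_vecMulVec e s _ hz0 hzs,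
      eval_charpoly_paddedDiagonal_add_vecMulVec e s _ hz0 hzs, eigenspaceNormSq_sqrtVector]
    intro i
    induction i using Fin.cases with
    | zero => simp only [eigenspaceNormSq, Fin.cons_zero]; positivity
    | succ i => simp only [eigenspaceNormSq, Fin.cons_succ]; positivity
  simp_rw [h1]
  have h2 := lintegral_cons_norm_sq e hΨm
  simp only [eigenspaceNormSq]
  rw [h2, lintegral_pos_eq_lintegral_interlaces hs]
  congr 1
  refine setLIntegral_congr_fun (isOpen_interlaces _).measurableSet fun x hx => ?_
  have hspos : ∀ i, 0 < s i := fun i => by simpa using hs (Fin.succ_pos i)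
  have hVx := det_vandermonde_pos (Interlaces.strictMono hx)
  have hVs := det_vandermonde_pos (s := s) fun i j hij => by
    simpa using hs (Fin.succ_lt_succ_iff.2 hij)
  have hps : 0 < ∏ i, s i := Finset.prod_pos fun i _ => hspos i
  have h3 : Ψ (rankOneWeight (Fin.cons 0 s) x) = F (paddedDiagonal e' x) := by
    refine hF.eq_of_charpoly_eq (hherm _) (isHermitian_paddedDiagonal _ _)
      (charpoly_paddedDiagonal_add_vecMulVec_eq e e' hs ?_)
    exact eigenspaceNormSq_sqrtVector e fun i => (rankOneWeight_pos hx hs i).le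
  rw [h3, ← mul_assoc, ← ENNReal.ofReal_mul (by positivity), det_vandermonde_cons_zero,
    rankOneWeight_cons_zero, abs_of_pos hVx, abs_of_pos (mul_pos hps hVs)]
  congr 2
  rw [div_pow]
  field_simp
  ring

theorem measurableSet_strictMono_pos (n : ℕ) :
    MeasurableSet {s : Fin n → ℝ | StrictMono s ∧ ∀ i, 0 < s i} := by
  have h : {s : Fin n → ℝ | StrictMono s ∧ ∀ i, 0 < s i} =
      (⋂ (i) (j) (_ : i < j), {s | s i < s j}) ∩ ⋂ i, {s | 0 < s i} := by
    ext s; simp [StrictMono]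
  rw [h]
  refine MeasurableSet.inter ?_ (MeasurableSet.iInter fun i =>
    measurableSet_lt measurable_const (measurable_pi_apply i))
  exact MeasurableSet.iInter fun i => MeasurableSet.iInter fun j => MeasurableSet.iInter fun _ =>
    measurableSet_lt (measurable_pi_apply i) (measurable_pi_apply j)

theorem measurable_det_vandermonde (n : ℕ) :
    Measurable fun s : Fin n → ℝ => (vandermonde s).det := by
  simp_rw [det_vandermonde]
  fun_prop

theorem strictMono_cons_zero {n : ℕ} {s : Fin n → ℝ} (hs : StrictMono s) (h0 : ∀ i, 0 < s i) :
    StrictMono (Fin.cons 0 s : Fin (n + 1) → ℝ) := by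
  intro i j hij
  induction j using Fin.cases with
  | zero => exact absurd hij (Fin.not_lt_zero i)
  | succ j =>
    induction i using Fin.cases with
    | zero => simpa using h0 j
    | succ i => simpa using hs (Fin.succ_lt_succ_iff.1 hij)

theorem interlaces_cons_zero_iff {n : ℕ} (s : Fin n → ℝ) (x : Fin (n + 1) → ℝ) :
    (StrictMono s ∧ ∀ i, 0 < s i) ∧ Interlaces (Fin.cons 0 s) x ↔
      (StrictMono x ∧ ∀ i, 0 < x i) ∧ ∀ i : Fin n, x i.castSucc < s i ∧ s i < x i.succ := by
  constructor
  · rintro ⟨⟨-, -⟩, hx⟩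
    have h0 : 0 < x 0 := by simpa using hx.1 0
    refine ⟨⟨hx.strictMono, fun i => h0.trans_le (hx.strictMono.monotone (Fin.zero_le i))⟩,
      fun i => ⟨by simpa using hx.2 i, by simpa using hx.1 i.succ⟩⟩
  · rintro ⟨⟨hx, h0⟩, hb⟩
    refine ⟨⟨fun i j hij => (hb i).2.trans_le
      ((hx.monotone (Fin.succ_le_castSucc_iff.2 hij)).trans (hb j).1.le),
      fun i => (h0 _).trans (hb i).1⟩, fun i => ?_, fun i => by simpa using (hb i).1⟩
    induction i using Fin.cases with
    | zero => simpa using h0 0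
    | succ i => simpa using (hb i).2

theorem lintegral_lintegral_interlaces {n : ℕ} {h : (Fin (n + 1) → ℝ) → ENNReal}
    (hh : Measurable h) :
    ∫⁻ s in {s : Fin n → ℝ | StrictMono s ∧ ∀ i, 0 < s i},
      ∫⁻ x in {x | Interlaces (Fin.cons 0 s) x}, ENNReal.ofReal (vandermonde s).det * h x =
    ∫⁻ x in {x : Fin (n + 1) → ℝ | StrictMono x ∧ ∀ i, 0 < x i},
      ENNReal.ofReal ((vandermonde x).det / n.factorial) * h x := by
  set T : Set ((Fin n → ℝ) × (Fin (n + 1) → ℝ)) :=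
    {q | (StrictMono q.2 ∧ ∀ i, 0 < q.2 i) ∧
      ∀ i : Fin n, q.2 i.castSucc < q.1 i ∧ q.1 i < q.2 i.succ} with hT
  set K : (Fin n → ℝ) × (Fin (n + 1) → ℝ) → ENNReal := fun q =>
    ENNReal.ofReal (vandermonde q.1).det * h q.2 with hK
  have hTm : MeasurableSet T := by
    have : T = Prod.snd ⁻¹' {x : Fin (n + 1) → ℝ | StrictMono x ∧ ∀ i, 0 < x i} ∩
        ⋂ i : Fin n, ({q : (Fin n → ℝ) × (Fin (n + 1) → ℝ) | q.2 i.castSucc < q.1 i} ∩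
          {q | q.1 i < q.2 i.succ}) := by
      ext q; simp [hT]
    rw [this]
    exact (measurable_snd (measurableSet_strictMono_pos _)).inter (MeasurableSet.iInter fun i =>
      (measurableSet_lt (by fun_prop) (by fun_prop)).inter
        (measurableSet_lt (by fun_prop) (by fun_prop)))
  have hKm : Measurable K :=
    ((measurable_det_vandermonde n).comp measurable_fst).ennreal_ofReal.mul
      (hh.comp measurable_snd)
  have h1 : ∀ s : Fin n → ℝ, {s : Fin n → ℝ | StrictMono s ∧ ∀ i, 0 < s i}.indicator
      (fun s => ∫⁻ x in {x | Interlaces (Fin.cons 0 s) x},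
        ENNReal.ofReal (vandermonde s).det * h x) s = ∫⁻ x, T.indicator K (s, x) := by
    intro s
    by_cases hs : StrictMono s ∧ ∀ i, 0 < s i
    · rw [Set.indicator_of_mem (by exact hs),
        ← lintegral_indicator (isOpen_interlaces _).measurableSet]
      refine lintegral_congr fun x => ?_
      have := interlaces_cons_zero_iff s x
      simp only [hs, implies_true, true_and, and_true] at this
      simp only [Set.indicator, hT, hK, Set.mem_ofPred_eq, this]
    · rw [Set.indicator_of_notMem (by exact hs), eq_comm,
        ← lintegral_zero (μ := (volume : Measure (Fin (n + 1) → ℝ)))]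
      refine lintegral_congr fun x => Set.indicator_of_notMem (fun hx => hs ?_) _
      exact ((interlaces_cons_zero_iff s x).2 hx).1
  rw [← lintegral_indicator (measurableSet_strictMono_pos n)]
  simp_rw [h1]
  rw [lintegral_lintegral_swap (f := fun s x => T.indicator K (s, x))
    (hKm.indicator hTm).aemeasurable, ← lintegral_indicator (measurableSet_strictMono_pos _)]
  refine lintegral_congr fun x => ?_
  by_cases hx : StrictMono x ∧ ∀ i, 0 < x i
  · have hbm : MeasurableSet {s : Fin n → ℝ | ∀ i, x i.castSucc < s i ∧ s i < x i.succ} := by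
      rw [show {s : Fin n → ℝ | ∀ i, x i.castSucc < s i ∧ s i < x i.succ} =
        Set.univ.pi fun i => Set.Ioo (x i.castSucc) (x i.succ) by ext s; simp]
      exact MeasurableSet.univ_pi fun _ => measurableSet_Ioo
    rw [Set.indicator_of_mem (by exact hx), ← lintegral_vandermonde_box hx.1,
      ← lintegral_mul_const _ (measurable_det_vandermonde n).ennreal_ofReal,
      ← lintegral_indicator hbm]
    refine lintegral_congr fun s => ?_
    simp [Set.indicator, hT, hK, hx]
  · rw [Set.indicator_of_notMem (by exact hx),
      ← lintegral_zero (μ := (volume : Measure (Fin n → ℝ)))]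
    exact lintegral_congr fun s => Set.indicator_of_notMem (fun h' => hx h'.1) _

theorem lintegral_conjTranspose_mul_self {ι : Type*} [Fintype ι] [DecidableEq ι] {n p : ℕ}
    (e : ι ≃ Fin n ⊕ Fin p) {F : Matrix ι ι ℂ → ENNReal} (hF : UnitarilyInvariant F)
    (hFm : Measurable fun A : ι → ι → ℂ => F (of A)) :
    ∫⁻ A : Fin n → ι → ℂ, F ((of A)ᴴ * of A) =
      ENNReal.ofReal (∏ i ∈ range n, Real.pi ^ (n + p) / ((p + i).factorial * i.factorial)) *
        ∫⁻ s in {s : Fin n → ℝ | StrictMono s ∧ ∀ i, 0 < s i},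
          ENNReal.ofReal ((vandermonde s).det ^ 2 * (∏ i, s i) ^ p) * F (paddedDiagonal e s) := by
  induction n generalizing p F with
  | zero =>
    have h1 : ∀ A : Fin 0 → ι → ℂ, (of A)ᴴ * of A = 0 := fun A => by
      ext i j; simp [Matrix.mul_apply]
    have h2 : ∀ s : Fin 0 → ℝ, paddedDiagonal e s = 0 := fun s => by
      ext i j
      rcases h : e i with k | k
      · exact k.elim0
      · simp [paddedDiagonal, diagonal_apply, h]
    have h3 : ∀ s : Fin 0 → ℝ, StrictMono s := Subsingleton.strictMono
    simp [h1, h2, h3, volume_pi]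
  | succ n ih =>
    have hcard : Fintype.card ι = n + 1 + p := by simpa using Fintype.card_congr e
    obtain ⟨e₀⟩ : Nonempty (ι ≃ Fin n ⊕ Fin (p + 1)) :=
      ⟨Fintype.equivOfCardEq (by simp [hcard]; ring)⟩
    have h0 := (volume_preserving_piFinSuccAbove (fun _ : Fin (n + 1) => ι → ℂ) 0).symm
    rw [← h0.lintegral_comp_emb (MeasurableEquiv.measurableEmbedding _)]
    have h1 : ∀ q : (ι → ℂ) × (Fin n → ι → ℂ),
        (of ((MeasurableEquiv.piFinSuccAbove (fun _ : Fin (n + 1) => ι → ℂ) 0).symm q))ᴴ *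
          of ((MeasurableEquiv.piFinSuccAbove (fun _ : Fin (n + 1) => ι → ℂ) 0).symm q) =
        (of q.2)ᴴ * of q.2 + vecMulVec (star q.1) q.1 := by
      rintro ⟨a, A⟩
      ext i j
      simp [MeasurableEquiv.piFinSuccAbove_symm_apply, Fin.insertNthEquiv_zero, Matrix.mul_apply,
        Fin.sum_univ_succ, vecMulVec, add_comm]
    simp_rw [h1]
    have hm : Measurable fun q : (ι → ℂ) × (Fin n → ι → ℂ) =>
        F ((of q.2)ᴴ * of q.2 + vecMulVec (star q.1) q.1) :=
      hFm.comp (f := fun (q : (ι → ℂ) × (Fin n → ι → ℂ)) i j =>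
        ∑ k, star (q.2 k i) * q.2 k j + star (q.1 i) * q.1 j) (by fun_prop)
    rw [Measure.volume_eq_prod, lintegral_prod_symm _ hm.aemeasurable]
    dsimp only
    rw [ih e₀ (hF.lintegral_add_vecMulVec hFm) (measurable_lintegral_add_vecMulVec hFm)]
    have hFd := measurable_paddedDiagonal e hFm
    set h : (Fin (n + 1) → ℝ) → ENNReal := fun x =>
      ENNReal.ofReal ((vandermonde x).det * (∏ j, x j) ^ p) * F (paddedDiagonal e x) with hh
    have hVm := measurable_det_vandermonde (n + 1)
    have hhm : Measurable h := (hVm.mul (by fun_prop)).ennreal_ofReal.mul hFd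
    have h2 : ∀ s : Fin n → ℝ, StrictMono s ∧ (∀ i, 0 < s i) →
        ENNReal.ofReal ((vandermonde s).det ^ 2 * (∏ i, s i) ^ (p + 1)) *
          ∫⁻ a : ι → ℂ, F (paddedDiagonal e₀ s + vecMulVec (star a) a) =
        ENNReal.ofReal (Real.pi ^ (n + p + 1) / p.factorial) *
          ∫⁻ x in {x | Interlaces (Fin.cons 0 s) x},
            ENNReal.ofReal (vandermonde s).det * h x := by
      rintro s ⟨hs, hpos⟩
      have hΔ := det_vandermonde_pos hs
      have hps : 0 < ∏ i, s i := Finset.prod_pos fun i _ => hpos i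
      rw [lintegral_paddedDiagonal_add_vecMulVec e₀ e (strictMono_cons_zero hs hpos) hF hFm,
        mul_left_comm, ← lintegral_const_mul' _ _ ENNReal.ofReal_ne_top]
      congr 1
      refine lintegral_congr fun x => ?_
      rw [hh, ← mul_assoc, ← mul_assoc, ← ENNReal.ofReal_mul (by positivity),
        ← ENNReal.ofReal_mul hΔ.le]
      congr 2
      field_simp
    rw [setLIntegral_congr_fun (measurableSet_strictMono_pos n) h2,
      lintegral_const_mul' _ _ ENNReal.ofReal_ne_top, lintegral_lintegral_interlaces hhm,
      ← mul_assoc, ← ENNReal.ofReal_mul (by positivity), ← lintegral_const_mul' _ _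
        ENNReal.ofReal_ne_top, ← lintegral_const_mul' _ _ ENNReal.ofReal_ne_top]
    refine setLIntegral_congr_fun (measurableSet_strictMono_pos _) fun x hx => ?_
    have hΔ := det_vandermonde_pos hx.1
    have hpx : 0 < ∏ i, x i := Finset.prod_pos fun i _ => hx.2 i
    rw [hh, ← mul_assoc, ← mul_assoc, ← mul_assoc, ← ENNReal.ofReal_mul (by positivity),
      ← ENNReal.ofReal_mul (by positivity), ← ENNReal.ofReal_mul (by positivity)]
    congr 2
    have hC : (∏ i ∈ range n, Real.pi ^ (n + (p + 1)) / ((p + 1 + i).factorial * i.factorial)) *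
        (Real.pi ^ (n + p + 1) / p.factorial) / n.factorial =
        ∏ i ∈ range (n + 1), Real.pi ^ (n + 1 + p) / ((p + i).factorial * i.factorial) := by
      simp_rw [Finset.prod_div_distrib, Finset.prod_mul_distrib, Finset.prod_const]
      rw [Finset.prod_range_succ' (fun i => ((p + i).factorial : ℝ)),
        Finset.prod_range_succ (fun i => (i.factorial : ℝ))]
      simp_rw [show ∀ i, p + 1 + i = p + (i + 1) by intro i; ring, card_range, add_zero]
      have e1 : n + (p + 1) = n + 1 + p := by ring
      have e2 : n + p + 1 = n + 1 + p := by ring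
      rw [e1, e2, pow_succ (Real.pi ^ (n + 1 + p)) n]
      field_simp
    rw [← hC]
    ring

theorem ae_injective (n : ℕ) : ∀ᵐ s : Fin n → ℝ, Function.Injective s := by
  have h : ∀ i j : Fin n, i ≠ j → ∀ᵐ s : Fin n → ℝ, s i ≠ s j := by
    intro i j hij
    have h0 := Measure.addHaar_submodule (volume : Measure (Fin n → ℝ))
      (LinearMap.ker ((LinearMap.proj i : (Fin n → ℝ) →ₗ[ℝ] ℝ) - LinearMap.proj j)) (by
        intro htop
        have : (Pi.single i 1 : Fin n → ℝ) ∈ LinearMap.ker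
            ((LinearMap.proj i : (Fin n → ℝ) →ₗ[ℝ] ℝ) - LinearMap.proj j) := htop ▸ trivial
        simp [Ne.symm hij] at this)
    refine measure_mono_null (fun s hs => ?_) h0
    simpa [sub_eq_zero] using hs
  simp only [Function.Injective]
  refine ae_all_iff.2 fun i => ae_all_iff.2 fun j => ?_
  by_cases hij : i = j
  · exact Filter.Eventually.of_forall fun _ _ => hij
  · filter_upwards [h i j hij] with s hs h' using absurd h' hs

theorem setIntegral_strictMono_sum_perm {n : ℕ} {h : (Fin n → ℝ) → ℝ}
    (hh : IntegrableOn h {s | ∀ i, 0 < s i}) :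
    IntegrableOn (fun s => ∑ τ : Equiv.Perm (Fin n), h (s ∘ τ))
      {s | StrictMono s ∧ ∀ i, 0 < s i} ∧
    ∫ s in {s : Fin n → ℝ | StrictMono s ∧ ∀ i, 0 < s i}, ∑ τ : Equiv.Perm (Fin n), h (s ∘ τ) =
      ∫ s in {s | ∀ i, 0 < s i}, h s := by
  set S : Set (Fin n → ℝ) := {s | StrictMono s ∧ ∀ i, 0 < s i} with hS
  have hmp : ∀ τ : Equiv.Perm (Fin n), MeasurePreserving (fun s : Fin n → ℝ => s ∘ τ) := fun τ =>
    (volume_measurePreserving_piCongrLeft (fun _ => ℝ) τ).symm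
  have hme : ∀ τ : Equiv.Perm (Fin n), MeasurableEmbedding (fun s : Fin n → ℝ => s ∘ τ) := fun τ =>
    (MeasurableEquiv.piCongrLeft (fun _ => ℝ) τ).symm.measurableEmbedding
  set E : Equiv.Perm (Fin n) → Set (Fin n → ℝ) := fun τ => (fun s => s ∘ τ.symm) ⁻¹' S with hE
  have hEm : ∀ τ, MeasurableSet (E τ) := fun τ =>
    (hmp τ.symm).measurable (measurableSet_strictMono_pos n)
  have hsub : ∀ τ, E τ ⊆ {s | ∀ i, 0 < s i} := fun τ s hs i => by
    simpa using hs.2 (τ i)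
  have hcomp : ∀ (τ : Equiv.Perm (Fin n)) (s : Fin n → ℝ), (s ∘ τ.symm) ∘ τ = s := fun τ s => by
    ext i; simp
  have h1 : ∀ τ : Equiv.Perm (Fin n), ∫ s in S, h (s ∘ τ) = ∫ s in E τ, h s := by
    intro τ
    rw [← (hmp τ.symm).setIntegral_preimage_emb (hme τ.symm) (fun s => h (s ∘ τ)) S]
    simp only [hcomp]; rfl
  have h2 : ∀ τ : Equiv.Perm (Fin n), IntegrableOn (fun s => h (s ∘ τ)) S := by
    intro τ
    rw [← (hmp τ.symm).integrableOn_comp_preimage (hme τ.symm)]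
    have : (fun s => h (s ∘ τ)) ∘ (fun s : Fin n → ℝ => s ∘ τ.symm) = h := by
      ext s; simp only [Function.comp_def, Equiv.symm_apply_apply]
    rw [this]
    exact hh.mono_set (hsub τ)
  have hsort : ∀ τ s, s ∈ E τ → τ.symm = Tuple.sort s := fun τ s hs =>
    Tuple.eq_sort_iff.2 ⟨hs.1.monotone, fun i j hij h' => absurd h' (hs.1 hij).ne⟩
  refine ⟨integrable_finsetSum _ fun τ _ => h2 τ, ?_⟩
  rw [integral_finsetSum _ fun τ _ => h2 τ]
  simp_rw [h1]
  rw [← integral_iUnion_fintype hEm]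
  · refine setIntegral_congr_set ?_
    filter_upwards [ae_injective n] with s hs
    refine propext ⟨fun hs' => ?_, fun hs' => ?_⟩
    · obtain ⟨τ, hτ⟩ := Set.mem_iUnion.1 hs'
      exact hsub τ hτ
    · refine Set.mem_iUnion.2 ⟨(Tuple.sort s).symm, ?_, fun i => hs' _⟩
      exact (Tuple.monotone_sort s).strictMono_of_injective
        (hs.comp (Tuple.sort s).injective)
  · intro τ τ' hne
    refine Set.disjoint_left.2 fun s hs hs' => hne ?_
    exact Equiv.symm_bijective.injective ((hsort τ s hs).trans (hsort τ' s hs').symm)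
  · exact fun τ => hh.mono_set (hsub τ)

theorem det_mul_prod_eq_sum_perm {n : ℕ} (s w : Fin n → ℝ) :
    (vandermonde s).det ^ 2 * ∏ i, w i =
      ∑ τ : Equiv.Perm (Fin n), (of fun i j : Fin n => s (τ i) ^ (i.1 + j.1) * w (τ i)).det := by
  have h : ∀ τ : Equiv.Perm (Fin n),
      (of fun i j : Fin n => s (τ i) ^ (i.1 + j.1) * w (τ i)).det =
      (∏ i, w i) * (vandermonde s).det * (Equiv.Perm.sign τ * ∏ i, vandermonde s (τ i) i) := by
    intro τ
    have h1 : (of fun i j : Fin n => s (τ i) ^ (i.1 + j.1) * w (τ i)) =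
        of fun i j : Fin n => (w (τ i) * s (τ i) ^ i.1) * ((vandermonde s).submatrix τ id) i j := by
      ext i j; simp [vandermonde_apply, pow_add]; ring
    rw [h1, det_mul_column, det_permute, Finset.prod_mul_distrib,
      Equiv.prod_comp τ w]
    simp only [vandermonde_apply]
    ring
  simp_rw [h]
  rw [← Finset.mul_sum, ← det_apply']
  ring

theorem setIntegral_vandermonde_sq {n : ℕ} {w : ℝ → ℝ}
    (hw : ∀ m : ℕ, IntegrableOn (fun y => y ^ m * w y) (Set.Ioi 0)) :
    IntegrableOn (fun s : Fin n → ℝ => (vandermonde s).det ^ 2 * ∏ i, w (s i))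
      {s | StrictMono s ∧ ∀ i, 0 < s i} ∧
    ∫ s in {s : Fin n → ℝ | StrictMono s ∧ ∀ i, 0 < s i},
      (vandermonde s).det ^ 2 * ∏ i, w (s i) =
    (of fun i j : Fin n => ∫ y in Set.Ioi (0 : ℝ), y ^ (i.1 + j.1) * w y).det := by
  have hset : {s : Fin n → ℝ | ∀ i, 0 < s i} = Set.univ.pi fun _ => Set.Ioi 0 := by
    ext s; simp
  have hvol : (volume : Measure (Fin n → ℝ)).restrict {s : Fin n → ℝ | ∀ i, 0 < s i} =
      Measure.pi fun _ => volume.restrict (Set.Ioi 0) := by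
    rw [hset, volume_pi, Measure.restrict_pi_pi]
  have hint : ∀ i j : Fin n, Integrable (fun y => y ^ (i.1 + j.1) * w y)
      (volume.restrict (Set.Ioi 0)) := fun i j => hw _
  have hdet : IntegrableOn (fun s : Fin n → ℝ =>
      (of fun i j : Fin n => s i ^ (i.1 + j.1) * w (s i)).det) {s | ∀ i, 0 < s i} := by
    rw [IntegrableOn, hvol]
    exact integrable_det hint
  simp_rw [fun s : Fin n → ℝ => det_mul_prod_eq_sum_perm s fun i => w (s i)]
  have key := setIntegral_strictMono_sum_perm hdet
  refine ⟨key.1, key.2.trans ?_⟩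
  rw [hvol]
  exact integral_det hint

theorem setIntegral_vandermonde_sq_mul_exp (n : ℕ) :
    IntegrableOn (fun s : Fin n → ℝ => (vandermonde s).det ^ 2 * ∏ i, Real.exp (-s i ^ 2))
      {s | StrictMono s ∧ ∀ i, 0 < s i} ∧
    ∫ s in {s : Fin n → ℝ | StrictMono s ∧ ∀ i, 0 < s i},
      (vandermonde s).det ^ 2 * ∏ i, Real.exp (-s i ^ 2) =
    (1 / 2) ^ n * (of fun i j : Fin n => Real.Gamma (((i.1 : ℝ) + j.1 + 1) / 2)).det := by
  have hint : ∀ m : ℕ, IntegrableOn (fun y : ℝ => y ^ m * Real.exp (-y ^ 2)) (Set.Ioi 0) := by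
    intro m
    have := integrableOn_rpow_mul_exp_neg_rpow (p := 2) (s := m)
      (by linarith [m.cast_nonneg (α := ℝ)]) two_pos
    simpa only [Real.rpow_natCast, Real.rpow_two] using this
  have key := setIntegral_vandermonde_sq (n := n) hint
  refine ⟨key.1, key.2.trans ?_⟩
  have h := det_smul (of fun i j : Fin n => Real.Gamma (((i.1 : ℝ) + j.1 + 1) / 2)) (1 / 2 : ℝ)
  rw [Fintype.card_fin] at h
  rw [← h]
  congr 1
  ext i j
  have := integral_rpow_mul_exp_neg_rpow (p := 2) (q := (i.1 + j.1 : ℕ)) two_pos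
    (by linarith [(i.1 + j.1).cast_nonneg (α := ℝ)])
  simp only [Real.rpow_natCast, Real.rpow_two] at this
  simp only [of_apply, Matrix.smul_apply, smul_eq_mul, this]
  push_cast
  rfl

theorem lintegral_exp_neg_trace_sq (k : ℕ) :
    ∫⁻ A : Fin k → Fin k → ℂ,
      ENNReal.ofReal (Real.exp (-(((of A)ᴴ * of A) * ((of A)ᴴ * of A)).trace.re)) =
    ENNReal.ofReal (∏ i ∈ range k, Real.pi ^ k / (i.factorial * i.factorial)) *
      ENNReal.ofReal ((1 / 2) ^ k *
        (of fun i j : Fin k => Real.Gamma (((i.1 : ℝ) + j.1 + 1) / 2)).det) := by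
  set F : Matrix (Fin k) (Fin k) ℂ → ENNReal := fun W =>
    ENNReal.ofReal (Real.exp (-(W * W).trace.re)) with hF
  have hinv : UnitarilyInvariant F := by
    intro U hU W
    have hUU : star U * U = 1 := (Unitary.mem_iff.1 hU).1
    have h : U * W * star U * (U * W * star U) = U * (W * W) * star U := by
      calc _ = U * W * (star U * U) * (W * star U) := by simp only [Matrix.mul_assoc]
        _ = _ := by rw [hUU, Matrix.mul_one]; simp only [Matrix.mul_assoc]
    simp only [hF]
    rw [h, Matrix.trace_mul_cycle, hUU, Matrix.one_mul]
  have hmeas : Measurable fun A : Fin k → Fin k → ℂ => F (of A) := by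
    simp only [hF, Matrix.trace, Matrix.diag, Matrix.mul_apply, of_apply]
    fun_prop
  obtain ⟨hi, hv⟩ := setIntegral_vandermonde_sq_mul_exp k
  change ∫⁻ A : Fin k → Fin k → ℂ, F ((of A)ᴴ * of A) = _
  rw [lintegral_conjTranspose_mul_self (Equiv.sumEmpty (Fin k) (Fin 0)).symm hinv hmeas, ← hv,
    ofReal_integral_eq_lintegral_ofReal hi (Filter.Eventually.of_forall fun s => by positivity)]
  simp only [add_zero, zero_add, pow_zero, mul_one]
  congr 1
  refine lintegral_congr fun s => ?_
  rw [ENNReal.ofReal_mul (sq_nonneg _), ← Real.exp_sum]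
  congr 3
  simp [hF, paddedDiagonal, Matrix.trace, sq]

/-- Quartic matrix integral evaluation: the normalization constant of the limiting edge
expression for `k` pairs of characteristic polynomials in the complex Ginibre ensemble. -/
theorem statement19 (k : ℕ) (hk : 1 ≤ k) :
    (∫ A : Fin k → Fin k → ℂ,
        Complex.exp (-((((Matrix.of A)ᴴ * Matrix.of A) * ((Matrix.of A)ᴴ * Matrix.of A)).trace)))
      = (Real.pi : ℂ) ^ (k ^ 2) /
          ((2 : ℂ) ^ k * ∏ j ∈ Finset.range k, ((Nat.factorial j : ℂ)) ^ 2) *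
        ((Matrix.of (fun a b : Fin k =>
            Real.Gamma (((a.1 : ℝ) + (b.1 : ℝ) + 1) / 2))).det : ℝ) := by
  have htrace : ∀ A : Fin k → Fin k → ℂ,
      Complex.exp (-(((of A)ᴴ * of A) * ((of A)ᴴ * of A)).trace) =
        ((Real.exp (-(((of A)ᴴ * of A) * ((of A)ᴴ * of A)).trace.re) : ℝ) : ℂ) := by
    intro A
    have hreal : (starRingEnd ℂ) (((of A)ᴴ * of A) * ((of A)ᴴ * of A)).trace =
        (((of A)ᴴ * of A) * ((of A)ᴴ * of A)).trace := by
      rw [starRingEnd_apply, ← trace_conjTranspose, conjTranspose_mul,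
        conjTranspose_mul (of A)ᴴ, conjTranspose_conjTranspose]
    rw [Complex.ofReal_exp, Complex.ofReal_neg, Complex.conj_eq_iff_re.1 hreal]
  have hcont : Continuous fun A : Fin k → Fin k → ℂ =>
      Real.exp (-(((of A)ᴴ * of A) * ((of A)ᴴ * of A)).trace.re) := by
    simp only [Matrix.trace, Matrix.diag, Matrix.mul_apply, conjTranspose_apply, of_apply]
    fun_prop
  have hnonneg : 0 ≤ (1 / 2 : ℝ) ^ k *
      (of fun i j : Fin k => Real.Gamma (((i.1 : ℝ) + j.1 + 1) / 2)).det := by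
    rw [← (setIntegral_vandermonde_sq_mul_exp k).2]
    exact integral_nonneg fun s => by positivity
  simp_rw [htrace]
  rw [integral_complex_ofReal, integral_eq_lintegral_of_nonneg_ae
    (Filter.Eventually.of_forall fun A => (Real.exp_pos _).le) hcont.aestronglyMeasurable,
    lintegral_exp_neg_trace_sq, ENNReal.toReal_mul, ENNReal.toReal_ofReal hnonneg,
    ENNReal.toReal_ofReal (Finset.prod_nonneg fun i _ => by positivity), Finset.prod_div_distrib,
    Finset.prod_const, card_range, ← pow_mul]
  push_cast
  simp_rw [← sq]
  rw [one_div, inv_pow, div_mul_eq_div_div_swap, div_eq_mul_inv _ ((2 : ℂ) ^ k)]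
  ring
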